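/- arXiv:2402.14688 — 3 statements merged into one kernel-verified Lean document; each statement's English description precedes it below -/
import Mathlib

section
/- Let A be a nonempty finite type, let p0 : A → ℝ be a probability mass function (p0 a ≥ 0 for all a and ∑_{a} p0 a = 1), let Q : A → ℝ, and let β > 0. For each k ≥ 1 and each a ∈ A define the k-sample softmax-reweighted policy π_k(a) = ∑_{ω : Fin k → A} (∏_{i} p0(ω i)) · ( (∑_{i} [ω i = a]) · exp(Q a / β) ) / ( ∑_{j} exp(Q (ω j) / β) ), where [ω i = a] denotes the indicator that the i-th sample equals a. Then for every a ∈ A, π_k(a) converges, as k → ∞, to p0(a) · exp(Q a / β) / ( ∑_{b} p0(b) · exp(Q b / β) ). -/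
open Filter

/-- Expectation over `k + 1` i.i.d. draws, conditioning on the first draw. -/
lemma iid_sum_succ {A : Type*} [Fintype A] (p f : A → ℝ) (F : ℝ → ℝ) (k : ℕ) :
    ∑ ω : Fin (k + 1) → A, (∏ i, p (ω i)) * F (∑ i, f (ω i)) =
      ∑ b, p b * ∑ ω : Fin k → A, (∏ i, p (ω i)) * F (f b + ∑ i, f (ω i)) := by
  rw [← (Fin.consEquiv fun _ : Fin (k + 1) => A).sum_comp, Fintype.sum_prod_type]
  simp [Fin.consEquiv, Fin.prod_univ_succ, Fin.sum_univ_succ, Finset.mul_sum, mul_assoc]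

lemma iid_sum_one {A : Type*} [Fintype A] (p : A → ℝ) (hp : ∑ a, p a = 1) (k : ℕ) :
    ∑ ω : Fin k → A, ∏ i, p (ω i) = 1 := by
  simpa [hp] using (Fintype.sum_pow p k).symm

lemma iid_sum_centered {A : Type*} [Fintype A] (p : A → ℝ) (hp : ∑ a, p a = 1)
    (f : A → ℝ) (hf : ∑ a, p a * f a = 0) (k : ℕ) :
    ∑ ω : Fin k → A, (∏ i, p (ω i)) * ∑ i, f (ω i) = 0 := by
  induction k with
  | zero => simp
  | succ k ih =>
    have h := iid_sum_succ p f id k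
    simp only [id] at h
    rw [h]
    simp only [mul_add, Finset.sum_add_distrib, ih, ← Finset.sum_mul, iid_sum_one p hp]
    simpa using hf

/-- The variance of a sum of i.i.d. centered variables is additive. -/
lemma iid_sum_sq_of_centered {A : Type*} [Fintype A] (p : A → ℝ) (hp : ∑ a, p a = 1)
    (f : A → ℝ) (hf : ∑ a, p a * f a = 0) (k : ℕ) :
    ∑ ω : Fin k → A, (∏ i, p (ω i)) * (∑ i, f (ω i)) ^ 2 = k * ∑ a, p a * f a ^ 2 := by
  induction k with
  | zero => simp
  | succ k ih =>
    rw [iid_sum_succ p f (· ^ 2) k]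
    have h (b : A) : ∑ ω : Fin k → A, (∏ i, p (ω i)) * (f b + ∑ i, f (ω i)) ^ 2 =
        f b ^ 2 + k * ∑ a, p a * f a ^ 2 := by
      calc _ = (∑ ω : Fin k → A, ∏ i, p (ω i)) * f b ^ 2
            + 2 * f b * (∑ ω : Fin k → A, (∏ i, p (ω i)) * ∑ i, f (ω i))
            + ∑ ω : Fin k → A, (∏ i, p (ω i)) * (∑ i, f (ω i)) ^ 2 := by
            rw [Finset.sum_mul, Finset.mul_sum, ← Finset.sum_add_distrib,
              ← Finset.sum_add_distrib]
            exact Finset.sum_congr rfl fun ω _ => by ring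
        _ = _ := by rw [iid_sum_one p hp, iid_sum_centered p hp f hf, ih]; ring
    simp only [h, mul_add, Finset.sum_add_distrib, ← Finset.sum_mul, hp]
    push_cast
    ring

/-- The mean absolute value of a sum of `k` i.i.d. centered variables is `O(√k)`. -/
lemma iid_sum_abs_le_of_centered {A : Type*} [Fintype A] (p : A → ℝ) (hp0 : ∀ a, 0 ≤ p a)
    (hp : ∑ a, p a = 1) (f : A → ℝ) (hf : ∑ a, p a * f a = 0) (k : ℕ) :
    ∑ ω : Fin k → A, (∏ i, p (ω i)) * |∑ i, f (ω i)| ≤ √k * √(∑ a, p a * f a ^ 2) := by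
  have hw (ω : Fin k → A) : 0 ≤ ∏ i, p (ω i) := Finset.prod_nonneg fun i _ => hp0 _
  rw [← Real.sqrt_mul (Nat.cast_nonneg k), ← iid_sum_sq_of_centered p hp f hf k]
  apply Real.le_sqrt_of_sq_le
  have h := Finset.sum_sq_le_sum_mul_sum_of_sq_le_mul Finset.univ
    (r := fun ω : Fin k → A => (∏ i, p (ω i)) * |∑ i, f (ω i)|)
    (f := fun ω : Fin k → A => ∏ i, p (ω i))
    (g := fun ω : Fin k → A => (∏ i, p (ω i)) * (∑ i, f (ω i)) ^ 2)
    (fun ω _ => hw ω) (fun ω _ => mul_nonneg (hw ω) (sq_nonneg _))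
    (fun ω _ => le_of_eq (by rw [mul_pow, sq_abs]; ring))
  rwa [iid_sum_one p hp, one_mul] at h

/-- Theorem 1 of the paper: the k-sample softmax-reweighted policy converges to the
Gibbs-tilted policy as k → ∞. -/
theorem qprobe_policy_limit {A : Type*} [Fintype A] [Nonempty A] [DecidableEq A]
    (p0 : A → ℝ) (hp0 : ∀ a, 0 ≤ p0 a) (hp0sum : ∑ a, p0 a = 1)
    (Q : A → ℝ) (β : ℝ) (hβ : 0 < β) (a : A) :
    Tendsto (fun k : ℕ =>
        ∑ ω : Fin k → A, (∏ i, p0 (ω i)) *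
          ((∑ i, if ω i = a then (1 : ℝ) else 0) * Real.exp (Q a / β)) /
          (∑ j, Real.exp (Q (ω j) / β)))
      atTop
      (nhds (p0 a * Real.exp (Q a / β) / ∑ b, p0 b * Real.exp (Q b / β))) := by
  let w (b : A) : ℝ := Real.exp (Q b / β)
  have hw (b : A) : 0 < w b := Real.exp_pos _
  obtain ⟨c, hc⟩ := Finite.exists_min w
  set Z := ∑ b, p0 b * w b with hZ
  have hZpos : 0 < Z := by
    calc 0 < w c := hw c
      _ = ∑ b, p0 b * w c := by rw [← Finset.sum_mul, hp0sum, one_mul]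
      _ ≤ Z := Finset.sum_le_sum fun b _ => mul_le_mul_of_nonneg_left (hc b) (hp0 b)
  set L := p0 a * w a / Z with hL
  let f (b : A) : ℝ := (if b = a then 1 else 0) * w a - L * w b
  have hf : ∑ b, p0 b * f b = 0 := by
    have h : ∑ b, p0 b * f b = p0 a * w a - L * Z := by
      simp [f, hZ, mul_sub, Finset.sum_sub_distrib, Finset.mul_sum, mul_left_comm]
    rw [h, hL, div_mul_cancel₀ _ hZpos.ne', sub_self]
  have hlim : Tendsto (fun k : ℕ => √(∑ b, p0 b * f b ^ 2) / w c / √(k : ℝ)) atTop (nhds 0) :=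
    tendsto_const_nhds.div_atTop
      (Real.tendsto_sqrt_atTop.comp tendsto_natCast_atTop_atTop)
  rw [tendsto_iff_norm_sub_tendsto_zero]
  refine squeeze_zero' (Eventually.of_forall fun _ => norm_nonneg _) ?_ hlim
  filter_upwards [eventually_gt_atTop 0] with k hk
  have hk' : (0 : ℝ) < k := Nat.cast_pos.2 hk
  have hP (ω : Fin k → A) : 0 ≤ ∏ i, p0 (ω i) := Finset.prod_nonneg fun i _ => hp0 _
  have hS (ω : Fin k → A) : k * w c ≤ ∑ j, w (ω j) := by
    simpa using Finset.sum_le_sum fun j (_ : j ∈ Finset.univ) => hc (ω j)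
  have hkw : 0 < k * w c := mul_pos hk' (hw c)
  have herr : ∑ ω : Fin k → A, (∏ i, p0 (ω i)) *
        ((∑ i, if ω i = a then (1 : ℝ) else 0) * w a) / (∑ j, w (ω j)) - L =
      ∑ ω : Fin k → A, (∏ i, p0 (ω i)) * ((∑ i, f (ω i)) / ∑ j, w (ω j)) := by
    have hmass : L = ∑ ω : Fin k → A, (∏ i, p0 (ω i)) * L := by
      rw [← Finset.sum_mul, iid_sum_one p0 hp0sum, one_mul]
    conv_lhs => rw [hmass]
    rw [← Finset.sum_sub_distrib]
    refine Finset.sum_congr rfl fun ω _ => ?_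
    have hne : ∑ j, w (ω j) ≠ 0 := (hkw.trans_le (hS ω)).ne'
    rw [Finset.sum_sub_distrib, ← Finset.sum_mul, ← Finset.mul_sum, sub_div,
      mul_div_cancel_right₀ _ hne]
    ring
  calc _ = |∑ ω : Fin k → A, (∏ i, p0 (ω i)) * ((∑ i, f (ω i)) / ∑ j, w (ω j))| :=
        congrArg abs herr
    _ ≤ ∑ ω : Fin k → A, (∏ i, p0 (ω i)) * |∑ i, f (ω i)| / (k * w c) := by
        refine (Finset.abs_sum_le_sum_abs _ _).trans (Finset.sum_le_sum fun ω _ => ?_)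
        rw [abs_mul, abs_of_nonneg (hP ω), abs_div, abs_of_pos (hkw.trans_le (hS ω)),
          mul_div_assoc]
        exact mul_le_mul_of_nonneg_left
          (div_le_div_of_nonneg_left (abs_nonneg _) hkw (hS ω)) (hP ω)
    _ ≤ √k * √(∑ b, p0 b * f b ^ 2) / (k * w c) := by
        rw [← Finset.sum_div]
        gcongr
        exact iid_sum_abs_le_of_centered p0 hp0 hp0sum f hf k
    _ = √(∑ b, p0 b * f b ^ 2) / w c / √(k : ℝ) := by
        have hsq : √(k : ℝ) ≠ 0 := (Real.sqrt_pos.2 hk').ne'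
        have hwc := (hw c).ne'
        rw [div_div, div_eq_div_iff hkw.ne' (mul_ne_zero hwc hsq)]
        linear_combination √(∑ b, p0 b * f b ^ 2) * w c * Real.mul_self_sqrt hk'.le
end

section
/- Let A be a nonempty finite type, let p0 : A → ℝ be a probability mass function with p0 a = 0 → π a = 0 hypothesis-free (all a allowed), let Q : A → ℝ and β > 0, and define π*(a) = p0(a) · exp(Q a / β) / ( ∑_b p0(b) · exp(Q b / β) ). If π : A → ℝ satisfies π a ≥ 0, ∑_a π a = 1, π a = 0 whenever p0 a = 0, and ∑_a π(a) Q(a) − β ∑_a π(a) log(π(a)/p0(a)) = ∑_a π*(a) Q(a) − β ∑_a π*(a) log(π*(a)/p0(a)) (with the convention 0·log 0 = 0), then π = π*. In other words, the Gibbs-tilted policy π* is the UNIQUE maximizer of the KL-regularized objective E_{a∼π}[Q(a)] − β · KL(π ‖ p0). -/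
open InformationTheory in
/-- Equality case of the Gibbs inequality on a finite type: vanishing relative entropy between
nonnegative functions of equal mass forces equality. -/
theorem eq_of_sum_mul_log_div_eq_zero {A : Type*} [Fintype A] {p q : A → ℝ}
    (hp : ∀ a, 0 ≤ p a) (hq : ∀ a, 0 ≤ q a) (hsum : ∑ a, p a = ∑ a, q a)
    (hac : ∀ a, q a = 0 → p a = 0) (hkl : ∑ a, p a * Real.log (p a / q a) = 0) :
    p = q := by
  have hterm : ∀ a, q a * klFun (p a / q a) = p a * Real.log (p a / q a) + q a - p a := by
    intro a
    by_cases ha : q a = 0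
    · simp [ha, hac a ha]
    · rw [klFun]
      field_simp
  have hzero : ∑ a, q a * klFun (p a / q a) = 0 := by
    simp only [hterm, Finset.sum_sub_distrib, Finset.sum_add_distrib]
    linarith
  have hnonneg : ∀ a ∈ Finset.univ, 0 ≤ q a * klFun (p a / q a) := fun a _ =>
    mul_nonneg (hq a) (klFun_nonneg (div_nonneg (hp a) (hq a)))
  funext a
  by_cases ha : q a = 0
  · rw [ha, hac a ha]
  · have h := (Finset.sum_eq_zero_iff_of_nonneg hnonneg).1 hzero a (Finset.mem_univ a)
    have h1 := (klFun_eq_zero_iff (div_nonneg (hp a) (hq a))).1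
      ((mul_eq_zero.1 h).resolve_left ha)
    exact (div_eq_one_iff_eq ha).1 h1

/-- The KL-regularized objective of `p` is `β * log Z` minus `β` times the relative entropy
of `p` with respect to the Gibbs tilt of `p0` with normalizer `Z`. -/
theorem klRegularized_eq_log_sub_kl_gibbs {A : Type*} [Fintype A] {p0 p Q : A → ℝ} {β Z : ℝ}
    (hβ : β ≠ 0) (hZ : Z ≠ 0) (hsum : ∑ a, p a = 1) (hac : ∀ a, p0 a = 0 → p a = 0) :
    ∑ a, p a * Q a - β * ∑ a, p a * Real.log (p a / p0 a) =
      β * Real.log Z -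
        β * ∑ a, p a * Real.log (p a / (p0 a * Real.exp (Q a / β) / Z)) := by
  have hterm : ∀ a, p a * Q a - β * (p a * Real.log (p a / p0 a)) =
      p a * (β * Real.log Z) -
        β * (p a * Real.log (p a / (p0 a * Real.exp (Q a / β) / Z))) := by
    intro a
    by_cases hpa : p a = 0
    · simp [hpa]
    · have h0 : p0 a ≠ 0 := fun h => hpa (hac a h)
      have he := Real.exp_ne_zero (Q a / β)
      rw [Real.log_div hpa h0, Real.log_div hpa (div_ne_zero (mul_ne_zero h0 he) hZ),
        Real.log_div (mul_ne_zero h0 he) hZ, Real.log_mul h0 he, Real.log_exp]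
      field_simp
      ring
  rw [Finset.mul_sum, Finset.mul_sum, ← Finset.sum_sub_distrib,
    Finset.sum_congr rfl fun a _ => hterm a, Finset.sum_sub_distrib, ← Finset.sum_mul, hsum,
    one_mul]

/-- Uniqueness half of Corollary 1 of the paper: any policy π (absolutely continuous
with respect to p0) whose KL-regularized objective value equals that of the
Gibbs-tilted policy π* must coincide with π*. -/
theorem qprobe_gibbs_unique_maximizer {A : Type*} [Fintype A] [Nonempty A]
    (p0 : A → ℝ) (hp0 : ∀ a, 0 ≤ p0 a) (hp0sum : ∑ a, p0 a = 1)
    (Q : A → ℝ) (β : ℝ) (hβ : 0 < β)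
    (π : A → ℝ) (hπ : ∀ a, 0 ≤ π a) (hπsum : ∑ a, π a = 1)
    (hac : ∀ a, p0 a = 0 → π a = 0)
    (heq : ∑ a, π a * Q a - β * ∑ a, π a * Real.log (π a / p0 a) =
      (∑ a, (p0 a * Real.exp (Q a / β) / ∑ b, p0 b * Real.exp (Q b / β)) * Q a) -
        β * ∑ a, (p0 a * Real.exp (Q a / β) / ∑ b, p0 b * Real.exp (Q b / β)) *
          Real.log ((p0 a * Real.exp (Q a / β) / ∑ b, p0 b * Real.exp (Q b / β)) / p0 a)) :
    π = fun a => p0 a * Real.exp (Q a / β) / ∑ b, p0 b * Real.exp (Q b / β) := by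
  have hnonneg : ∀ a, 0 ≤ p0 a * Real.exp (Q a / β) := fun a =>
    mul_nonneg (hp0 a) (Real.exp_pos _).le
  have hZ : 0 < ∑ b, p0 b * Real.exp (Q b / β) := by
    refine (Finset.sum_nonneg fun a _ => hnonneg a).lt_of_ne' fun h => ?_
    have hp0zero : ∀ a, p0 a = 0 := fun a =>
      (mul_eq_zero.1 ((Finset.sum_eq_zero_iff_of_nonneg fun a _ => hnonneg a).1 h a
        (Finset.mem_univ a))).resolve_right (Real.exp_ne_zero _)
    simp [hp0zero] at hp0sum
  have hgsum : ∑ a, p0 a * Real.exp (Q a / β) / ∑ b, p0 b * Real.exp (Q b / β) = 1 := by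
    rw [← Finset.sum_div, div_self hZ.ne']
  have hself : ∀ x : ℝ, x * Real.log (x / x) = 0 := fun x => by
    by_cases hx : x = 0 <;> simp [hx]
  rw [klRegularized_eq_log_sub_kl_gibbs hβ.ne' hZ.ne' hπsum hac,
    klRegularized_eq_log_sub_kl_gibbs hβ.ne' hZ.ne' hgsum fun a ha => by simp [ha]] at heq
  simp only [hself, Finset.sum_const_zero, mul_zero, sub_zero, sub_eq_self, mul_eq_zero,
    hβ.ne', false_or] at heq
  refine eq_of_sum_mul_log_div_eq_zero hπ (fun a => div_nonneg (hnonneg a) hZ.le)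
    (hπsum.trans hgsum.symm) (fun a ha => hac a ?_) heq
  simpa [hZ.ne'] using ha
end

section
/- Let A be a nonempty finite type, p0 : A → ℝ a probability mass function (p0 a ≥ 0, ∑_a p0 a = 1), Q : A → ℝ, β > 0, and write f(a) = exp(Q a / β). Fix a ∈ A. For k ≥ 2 define ρ_k(a) = ∑_{ω : Fin (k−1) → A} ( ∏_i p0(ω i) ) · f(a) / ( f(a) + ∑_{i} f(ω i) ), the expected softmax weight of a against k − 1 additional i.i.d. samples from p0. Then k · ρ_k(a) converges, as k → ∞, to f(a) / ( ∑_b p0(b) · f(b) ). -/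
open Filter

section IIDSums

variable {A : Type*} [Fintype A]

/-- Splitting off the first sample in an expectation over `n + 1` i.i.d. samples. -/
theorem sum_prod_mul_fin_succ (p : A → ℝ) (n : ℕ) (F : (Fin (n + 1) → A) → ℝ) :
    ∑ ω, (∏ i, p (ω i)) * F ω =
      ∑ x, p x * ∑ ω : Fin n → A, (∏ i, p (ω i)) * F (Fin.cons x ω) := by
  rw [← (Fin.consEquiv fun _ : Fin (n + 1) => A).sum_comp, Fintype.sum_prod_type]
  refine Finset.sum_congr rfl fun x _ => ?_
  rw [Finset.mul_sum]
  refine Finset.sum_congr rfl fun ω _ => ?_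
  simp [Fin.consEquiv, Fin.prod_univ_succ, mul_assoc]

/-- The product weights of a probability mass function sum to one. -/
theorem sum_prod_eq_one {p : A → ℝ} (hp : ∑ x, p x = 1) (n : ℕ) :
    ∑ ω : Fin n → A, ∏ i, p (ω i) = 1 := by
  rw [← Fintype.sum_pow, hp, one_pow]

/-- The mean of a shifted sum of centred i.i.d. variables. -/
theorem sum_prod_mul_add_sum {p g : A → ℝ} (hp : ∑ x, p x = 1) (hg : ∑ x, p x * g x = 0)
    (n : ℕ) (c : ℝ) : ∑ ω : Fin n → A, (∏ i, p (ω i)) * (c + ∑ i, g (ω i)) = c := by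
  induction n generalizing c with
  | zero => simp
  | succ n ih =>
    rw [sum_prod_mul_fin_succ]
    simp only [Fin.sum_univ_succ, Fin.cons_zero, Fin.cons_succ, ← add_assoc, ih]
    simp only [mul_add, Finset.sum_add_distrib, ← Finset.sum_mul, hp, hg, one_mul, add_zero]

/-- The second moment of a shifted sum of centred i.i.d. variables. -/
theorem sum_prod_mul_add_sum_sq {p g : A → ℝ} (hp : ∑ x, p x = 1) (hg : ∑ x, p x * g x = 0)
    (n : ℕ) (c : ℝ) :
    ∑ ω : Fin n → A, (∏ i, p (ω i)) * (c + ∑ i, g (ω i)) ^ 2 =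
      c ^ 2 + n * ∑ x, p x * g x ^ 2 := by
  induction n generalizing c with
  | zero => simp
  | succ n ih =>
    rw [sum_prod_mul_fin_succ]
    simp only [Fin.sum_univ_succ, Fin.cons_zero, Fin.cons_succ, ← add_assoc, ih]
    set V := ∑ x, p x * g x ^ 2 with hV
    have expand (x : A) : p x * ((c + g x) ^ 2 + n * V) =
        p x * (c ^ 2 + n * V) + 2 * c * (p x * g x) + p x * g x ^ 2 := by ring
    simp only [expand, Finset.sum_add_distrib, ← Finset.sum_mul, ← Finset.mul_sum, hp, hg, ← hV]
    push_cast
    ring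

/-- Two-sided bound on the expected self-normalised weight of `a` against `n` i.i.d. samples. -/
theorem softmax_weight_bounds {p f : A → ℝ} (hp0 : ∀ x, 0 ≤ p x) (hp : ∑ x, p x = 1)
    {m : ℝ} (hm : 0 < m) (hf : ∀ x, m ≤ f x) {μ : ℝ} (hμ : ∑ x, p x * f x = μ) (hμ0 : 0 < μ)
    (a : A) (n : ℕ) :
    f a / μ - f a * (f a - μ) / μ ^ 2 / (n + 1) ≤
        (n + 1) * ∑ ω : Fin n → A, (∏ i, p (ω i)) * (f a / (f a + ∑ i, f (ω i))) ∧
      (n + 1) * ∑ ω : Fin n → A, (∏ i, p (ω i)) * (f a / (f a + ∑ i, f (ω i))) ≤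
        f a / μ - f a * (f a - μ) / μ ^ 2 / (n + 1) +
          f a * ((f a - μ) ^ 2 + ∑ x, p x * (f x - μ) ^ 2) / (m * μ ^ 2) / (n + 1) := by
  have hk : (0 : ℝ) < n + 1 := by positivity
  have hfa : 0 < f a := hm.trans_le (hf a)
  have hg : ∑ x, p x * (f x - μ) = 0 := by
    simp only [mul_sub, Finset.sum_sub_distrib, ← Finset.sum_mul, hp, hμ, one_mul, sub_self]
  have hw (ω : Fin n → A) : 0 ≤ ∏ i, p (ω i) := Finset.prod_nonneg fun i _ => hp0 _
  have hD (ω : Fin n → A) : m * (n + 1) ≤ f a + ∑ i, f (ω i) := by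
    have h := Finset.card_nsmul_le_sum Finset.univ (fun i => f (ω i)) m fun i _ => hf _
    simp only [Finset.card_univ, Fintype.card_fin, nsmul_eq_mul] at h
    linarith [hf a]
  have expansion (ω : Fin n → A) :
      (n + 1) * (f a / (f a + ∑ i, f (ω i))) =
        f a / μ - f a / μ ^ 2 / (n + 1) * (f a - μ + ∑ i, (f (ω i) - μ)) +
        f a / (μ ^ 2 * (n + 1)) *
          ((f a - μ + ∑ i, (f (ω i) - μ)) ^ 2 / (f a + ∑ i, f (ω i))) := by
    have hpos := (mul_pos hm hk).trans_le (hD ω)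
    simp only [Finset.sum_sub_distrib, Finset.sum_const, Finset.card_univ, Fintype.card_fin,
      nsmul_eq_mul]
    generalize ∑ i, f (ω i) = S at hpos ⊢
    field_simp
    ring
  have expectation : (n + 1) * ∑ ω : Fin n → A, (∏ i, p (ω i)) * (f a / (f a + ∑ i, f (ω i))) =
      f a / μ - f a * (f a - μ) / μ ^ 2 / (n + 1) + f a / (μ ^ 2 * (n + 1)) *
        ∑ ω : Fin n → A, (∏ i, p (ω i)) *
          ((f a - μ + ∑ i, (f (ω i) - μ)) ^ 2 / (f a + ∑ i, f (ω i))) := by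
    have hconst : f a / μ = ∑ ω : Fin n → A, (∏ i, p (ω i)) * (f a / μ) := by
      rw [← Finset.sum_mul, sum_prod_eq_one hp, one_mul]
    have hlinear : f a * (f a - μ) / μ ^ 2 / (n + 1) = f a / μ ^ 2 / (n + 1) *
        ∑ ω : Fin n → A, (∏ i, p (ω i)) * (f a - μ + ∑ i, (f (ω i) - μ)) := by
      rw [sum_prod_mul_add_sum hp hg]
      ring
    rw [hlinear, hconst, Finset.mul_sum, Finset.mul_sum, Finset.mul_sum,
      ← Finset.sum_sub_distrib, ← Finset.sum_add_distrib]
    refine Finset.sum_congr rfl fun ω _ => ?_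
    rw [mul_left_comm, expansion]
    ring
  have remainder_nonneg : 0 ≤ ∑ ω : Fin n → A, (∏ i, p (ω i)) *
      ((f a - μ + ∑ i, (f (ω i) - μ)) ^ 2 / (f a + ∑ i, f (ω i))) :=
    Finset.sum_nonneg fun ω _ => mul_nonneg (hw ω)
      (div_nonneg (sq_nonneg _) ((mul_pos hm hk).le.trans (hD ω)))
  have remainder_le : ∑ ω : Fin n → A, (∏ i, p (ω i)) *
      ((f a - μ + ∑ i, (f (ω i) - μ)) ^ 2 / (f a + ∑ i, f (ω i))) ≤
        ((f a - μ) ^ 2 + ∑ x, p x * (f x - μ) ^ 2) / m := by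
    have hV : 0 ≤ ∑ x, p x * (f x - μ) ^ 2 :=
      Finset.sum_nonneg fun x _ => mul_nonneg (hp0 x) (sq_nonneg _)
    calc _ ≤ ∑ ω : Fin n → A, (∏ i, p (ω i)) *
          (f a - μ + ∑ i, (f (ω i) - μ)) ^ 2 / (m * (n + 1)) := by
            refine Finset.sum_le_sum fun ω _ => ?_
            rw [mul_div_assoc]
            exact mul_le_mul_of_nonneg_left
              (div_le_div_of_nonneg_left (sq_nonneg _) (mul_pos hm hk) (hD ω)) (hw ω)
      _ = ((f a - μ) ^ 2 + n * ∑ x, p x * (f x - μ) ^ 2) / (m * (n + 1)) := by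
            rw [← Finset.sum_div, sum_prod_mul_add_sum_sq hp hg]
      _ ≤ _ := by
            rw [div_le_div_iff₀ (mul_pos hm hk) hm]
            have : 0 ≤ m * (n * (f a - μ) ^ 2 + ∑ x, p x * (f x - μ) ^ 2) := by positivity
            linarith
  rw [expectation]
  have hcoef : 0 ≤ f a / (μ ^ 2 * (n + 1)) := by positivity
  refine ⟨le_add_of_nonneg_right (mul_nonneg hcoef remainder_nonneg), ?_⟩
  gcongr
  refine (mul_le_mul_of_nonneg_left remainder_le hcoef).trans_eq ?_
  field_simp

end IIDSums

/-- Consistency of the softmax selection probability used in the policy-gradient loss: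
with f(a) = exp(Q(a)/β), the expected softmax weight ρ_k(a) of `a` against k − 1
additional i.i.d. samples from p0, rescaled by k, converges to the density ratio
f(a) / ∑_b p0(b) f(b) as k → ∞. -/
theorem qprobe_softmax_weight_limit {A : Type*} [Fintype A] [Nonempty A]
    (p0 : A → ℝ) (hp0 : ∀ a, 0 ≤ p0 a) (hp0sum : ∑ a, p0 a = 1)
    (Q : A → ℝ) (β : ℝ) (hβ : 0 < β) (a : A) :
    Tendsto (fun k : ℕ =>
        (k : ℝ) * ∑ ω : Fin (k - 1) → A, (∏ i, p0 (ω i)) *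
          (Real.exp (Q a / β) / (Real.exp (Q a / β) + ∑ i, Real.exp (Q (ω i) / β))))
      atTop
      (nhds (Real.exp (Q a / β) / ∑ b, p0 b * Real.exp (Q b / β))) := by
  obtain ⟨x₀, hx₀⟩ := Finite.exists_min fun x => Real.exp (Q x / β)
  have hm : 0 < Real.exp (Q x₀ / β) := Real.exp_pos _
  have hμ : 0 < ∑ b, p0 b * Real.exp (Q b / β) :=
    calc 0 < Real.exp (Q x₀ / β) := hm
      _ = ∑ b, p0 b * Real.exp (Q x₀ / β) := by rw [← Finset.sum_mul, hp0sum, one_mul]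
      _ ≤ _ := Finset.sum_le_sum fun b _ => mul_le_mul_of_nonneg_left (hx₀ b) (hp0 b)
  have bounds := softmax_weight_bounds hp0 hp0sum hm hx₀ rfl hμ a
  have hlim (C : ℝ) : Tendsto (fun n : ℕ => C / ((n : ℝ) + 1)) atTop (nhds 0) :=
    tendsto_const_nhds.div_atTop
      (tendsto_atTop_add_const_right _ _ tendsto_natCast_atTop_atTop)
  rw [← tendsto_add_atTop_iff_nat 1]
  simp only [Nat.cast_add, Nat.cast_one]
  refine tendsto_of_tendsto_of_tendsto_of_le_of_le ?_ ?_
    (fun n => (bounds n).1) (fun n => (bounds n).2)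
  · simpa only [sub_zero] using tendsto_const_nhds.sub (hlim _)
  · simpa only [sub_zero, add_zero] using (tendsto_const_nhds.sub (hlim _)).add (hlim _)
end
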